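/- arXiv:1108.4032 — 4 statements merged into one kernel-verified Lean document; each statement's English description precedes it below -/
import Mathlib

section
/- Let D and E be locally small categories, and suppose given functors q, s : D → E and r : E → D with adjunctions q ⊣ r and r ⊣ s, such that q and s are fully faithful and q preserves finite limits. If E is lex totally distributive (there are t ⊣ c ⊣ y_E with t preserving finite limits), then D is lex totally distributive: there exist t' ⊣ c' ⊣ y_D with t' : D → D̂ preserving finite limits. -/
open CategoryTheory CategoryTheory.Limits

universe v u₁ u₂

/-- A locally small category `E` is totally distributive if there exist functors
`t : E ⥤ Ê` and `c : Ê ⥤ E` with adjunctions `t ⊣ c` and `c ⊣ y_E`; it is *lex*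
totally distributive if moreover `t` can be chosen to preserve finite limits. -/
def LexTotallyDistributive (E : Type u₁) [Category.{v} E] : Prop :=
  ∃ (t : E ⥤ (Eᵒᵖ ⥤ Type v)) (c : (Eᵒᵖ ⥤ Type v) ⥤ E),
    Nonempty (t ⊣ c) ∧ Nonempty (c ⊣ yoneda) ∧ PreservesFiniteLimits t

/-- Given adjunctions `q ⊣ r ⊣ s : D ⥤ E` with `q`, `s` fully faithful and
`q` preserving finite limits, if `E` is lex totally distributive then so is `D`. -/
theorem lexTotallyDistributive_of_adjoint_triple
    {D : Type u₁} [Category.{v} D] {E : Type u₂} [Category.{v} E]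
    (q s : D ⥤ E) (r : E ⥤ D)
    (adj₁ : q ⊣ r) (adj₂ : r ⊣ s)
    [q.Full] [q.Faithful] [s.Full] [s.Faithful]
    [PreservesFiniteLimits q]
    (hE : LexTotallyDistributive E) :
    LexTotallyDistributive D := by
  obtain ⟨t, c, ⟨adjt⟩, ⟨adjc⟩, ht⟩ := hE
  let qr := adj₁.op.whiskerLeft (Type v)
  let rs := adj₂.op.whiskerLeft (Type v)
  let yonedaIso : s ⋙ yoneda ⋙ (Functor.whiskeringLeft _ _ (Type v)).obj s.op ≅ yoneda :=
    NatIso.ofComponents fun d => NatIso.ofComponents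
      (fun _ => (Functor.FullyFaithful.ofFullyFaithful s).homEquiv.symm.toIso)
      (fun _ => by ext; apply s.map_injective; simp [Functor.FullyFaithful.homEquiv])
  refine ⟨q ⋙ t ⋙ (Functor.whiskeringLeft _ _ (Type v)).obj q.op,
    (Functor.whiskeringLeft _ _ (Type v)).obj r.op ⋙ c ⋙ r,
    ⟨adj₁.comp (adjt.comp qr)⟩, ⟨(rs.comp (adjc.comp adj₂)).ofNatIsoRight yonedaIso⟩, ?_⟩
  infer_instance
end

section
/- Let i : C → D be a fully faithful functor with a right adjoint r : D → C, and suppose the induced comonad on D (the endofunctor d ↦ i(r(d))) has a right adjoint n : D → D. Then the functor s : C → D given by s(c) := n(i(c)) is right adjoint to r, so that there is an adjoint triple i ⊣ r ⊣ s. -/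
open CategoryTheory

universe v₁ v₂ u₁ u₂

/-- Let `i : C ⥤ D` be fully faithful with right adjoint `r`, and suppose
the induced comonad `i ∘ r` on `D` (as an endofunctor, `r ⋙ i` in diagrammatic order
applied after `r`, i.e. `d ↦ i (r d)`) has a right adjoint `n`. Then `s := n ∘ i`
(i.e. `c ↦ n (i c)`) is right adjoint to `r`, giving an adjoint triple `i ⊣ r ⊣ s`. -/
theorem right_adjoint_of_idempotent_comonad_right_adjoint
    {C : Type u₁} [Category.{v₁} C] {D : Type u₂} [Category.{v₂} D]
    (i : C ⥤ D) [i.Full] [i.Faithful] (r : D ⥤ C) (adj : i ⊣ r)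
    (n : D ⥤ D) (adj' : (r ⋙ i) ⊣ n) :
    Nonempty (r ⊣ (i ⋙ n)) := by
  exact ⟨adj'.restrictFullyFaithful (Functor.FullyFaithful.id D)
    (Functor.FullyFaithful.ofFullyFaithful i) (r ⋙ i).leftUnitor (i ⋙ n).rightUnitor.symm⟩
end

section
/- Every quasi-injective topos is totally distributive: let E be a locally small category which is a retract, by geometric morphisms, of a presheaf topos on a small category C, i.e., there exist functors s_* : E → Ĉ with a finite-limit-preserving left adjoint s* : Ĉ → E, and r_* : Ĉ → E with a finite-limit-preserving left adjoint r* : E → Ĉ, such that the composite of s_* followed by r_* is naturally isomorphic to the identity on E. Then E is totally distributive. -/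
open CategoryTheory CategoryTheory.Limits

universe v u

/-- A locally small category `E` is *totally distributive* if there exist functors
`t : E ⥤ Ê` and `c : Ê ⥤ E` with adjunctions `t ⊣ c` and `c ⊣ y_E`. -/
def TotallyDistributive (E : Type u) [Category.{v} E] : Prop :=
  ∃ (t : E ⥤ (Eᵒᵖ ⥤ Type v)) (c : (Eᵒᵖ ⥤ Type v) ⥤ E),
    Nonempty (t ⊣ c) ∧ Nonempty (c ⊣ yoneda)

open CategoryTheory.Functor Opposite

namespace CategoryTheory

/-- A category with equalizers is idempotent complete. -/
lemma isIdempotentComplete_of_hasEqualizers (A : Type*) [Category* A] [HasEqualizers A] :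
    IsIdempotentComplete A :=
  (Idempotents.isIdempotentComplete_iff_hasEqualizer_of_id_and_idempotent A).2
    fun _ _ _ => inferInstance

/-- If the identity of `E` factors, up to isomorphism, through a category with limits of shape `J`
by functors the second of which preserves these limits, then `E` has limits of shape `J`. -/
lemma hasLimitsOfShape_of_retract {J A E : Type*} [Category* J] [Category* A] [Category* E]
    [HasLimitsOfShape J A] (s : E ⥤ A) (r : A ⥤ E) [PreservesLimitsOfShape J r]
    (e : s ⋙ r ≅ 𝟭 E) : HasLimitsOfShape J E where
  has_limit F :=
    hasLimit_of_iso (F := (F ⋙ s) ⋙ r) (associator F s r ≪≫ isoWhiskerLeft F e ≪≫ F.rightUnitor)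

/-- Let `η : 𝟭 ⟶ L ⋙ R` and `ε : R ⋙ L ⟶ 𝟭` satisfy the triangle identity at `R`. If the target
of `L` is idempotent complete, then `R` has a left adjoint, which is a retract of `L`. -/
theorem exists_leftAdjoint_retract {A B : Type*} [Category* A] [Category* B]
    [IsIdempotentComplete B] (L : A ⥤ B) (R : B ⥤ A) (η : 𝟭 A ⟶ L ⋙ R) (ε : R ⋙ L ⟶ 𝟭 B)
    (h : ∀ X, η.app (R.obj X) ≫ R.map (ε.app X) = 𝟙 (R.obj X)) :
    ∃ (L' : A ⥤ B) (i : L' ⟶ L) (p : L ⟶ L'), i ≫ p = 𝟙 L' ∧ Nonempty (L' ⊣ R) := by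
  let e : L ⟶ L :=
    { app X := L.map (η.app X) ≫ ε.app (L.obj X)
      naturality X Y f := by
        have h₁ := η.naturality f
        have h₂ := ε.naturality (L.map f)
        dsimp at h₁ h₂
        rw [← L.map_comp_assoc, h₁, L.map_comp_assoc, h₂, Category.assoc] }
  have he : e ≫ e = e := by
    ext X
    have h₁ := ε.naturality (L.map (η.app X))
    have h₂ := ε.naturality (ε.app (L.obj X))
    have h₃ := η.naturality (η.app X)
    dsimp at h₁ h₂ h₃
    dsimp [e]
    rw [Category.assoc, ← reassoc_of% h₁, ← h₂, ← L.map_comp_assoc, ← h₃, ← L.map_comp_assoc,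
      Category.assoc, h, Category.comp_id]
  obtain ⟨L', i, p, hip, hpi⟩ := IsIdempotentComplete.idempotents_split L e he
  have hpi' (X : A) : p.app X ≫ i.app X = L.map (η.app X) ≫ ε.app (L.obj X) :=
    congr_app hpi X
  have hip' (X : A) : i.app X ≫ p.app X = 𝟙 _ := congr_app hip X
  refine ⟨L', i, p, hip, ⟨Adjunction.mkOfUnitCounit
    { unit := η ≫ whiskerRight p R
      counit := whiskerLeft R i ≫ ε
      left_triangle := ?_
      right_triangle := ?_ }⟩⟩
  · ext X
    have h₁ := i.naturality (η.app X ≫ R.map (p.app X))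
    have h₂ := ε.naturality (p.app X)
    dsimp at h₁ h₂ ⊢
    rw [Category.id_comp, reassoc_of% h₁, L.map_comp_assoc, h₂, ← reassoc_of% hpi' X,
      hip', Category.comp_id, hip']
  · ext X
    have h₁ := ε.naturality (ε.app X)
    dsimp at h₁ ⊢
    rw [Category.id_comp, Category.assoc, ← R.map_comp, reassoc_of% hpi' (R.obj X), ← h₁,
      ← L.map_comp_assoc, h, L.map_id, Category.id_comp, h]

/-- A retract of a right adjoint is a right adjoint when the target of the left adjoint is
idempotent complete. -/
theorem isRightAdjoint_of_retract {A B : Type*} [Category* A] [Category* B]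
    [IsIdempotentComplete B] {L : A ⥤ B} {R R' : B ⥤ A} (adj : L ⊣ R)
    (i : R' ⟶ R) (p : R ⟶ R') (hip : i ≫ p = 𝟙 R') : R'.IsRightAdjoint := by
  obtain ⟨L', -, -, -, ⟨adj'⟩⟩ := exists_leftAdjoint_retract L R'
    (adj.unit ≫ whiskerLeft L p) (whiskerRight i L ≫ adj.counit) (fun X => by
      have h₁ := p.naturality (L.map (i.app X) ≫ adj.counit.app X)
      have h₂ := adj.unit.naturality (i.app X)
      have h₃ : i.app X ≫ p.app X = 𝟙 _ := congr_app hip X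
      dsimp at h₁ h₂ ⊢
      rw [Category.assoc, ← h₁, R.map_comp_assoc, ← reassoc_of% h₂,
        adj.right_triangle_components_assoc, h₃])
  exact adj'.isRightAdjoint

/-- If a functor `c` on presheaves restricts to the identity along the Yoneda embedding, then an
element of `P` at `X` induces a morphism from `X` to `c P`, naturally in `P`. -/
def toYonedaOfCompIso {E : Type u} [Category.{v} E] (c : (Eᵒᵖ ⥤ Type v) ⥤ E)
    (e : yoneda ⋙ c ≅ 𝟭 E) : 𝟭 (Eᵒᵖ ⥤ Type v) ⟶ c ⋙ yoneda where
  app P :=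
    { app Z := TypeCat.ofHom fun x => e.inv.app Z.unop ≫ c.map (yonedaEquiv.symm x)
      naturality Z W f := by
        ext x
        have h := e.inv.naturality f.unop
        dsimp at h x ⊢
        rw [yonedaEquiv_symm_map, c.map_comp, reassoc_of% h] }
  naturality P Q f := by
    ext Z x
    dsimp at x ⊢
    rw [Category.assoc, ← c.map_comp, yonedaEquiv_symm_naturality_right]

/-- A functor `c` on the presheaves on `E` which has a left adjoint and restricts to the identity
along the Yoneda embedding exhibits `E` as totally distributive, provided `E` is idempotent
complete. -/
theorem totallyDistributive_of_yoneda_comp_iso {E : Type u} [Category.{v} E]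
    [IsIdempotentComplete E] {t : E ⥤ (Eᵒᵖ ⥤ Type v)} {c : (Eᵒᵖ ⥤ Type v) ⥤ E}
    (adj : t ⊣ c) (e : yoneda ⋙ c ≅ 𝟭 E) : TotallyDistributive E := by
  obtain ⟨c', i, p, hip, hc'⟩ := exists_leftAdjoint_retract c yoneda (toYonedaOfCompIso c e) e.hom
    (fun X => by
      ext Z x
      have h := e.hom.naturality x
      dsimp [toYonedaOfCompIso] at h x ⊢
      have hx : yonedaEquiv.symm x = yoneda.map x :=
        yonedaEquiv.symm_apply_eq.2 (yonedaEquiv_yoneda_map x).symm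
      rw [Category.assoc, hx, h, e.inv_hom_id_app_assoc])
  have := isIdempotentComplete_of_hasEqualizers (Type v)
  have := isRightAdjoint_of_retract adj i p hip
  exact ⟨c'.leftAdjoint, c', ⟨Adjunction.ofIsRightAdjoint c'⟩, hc'⟩

end CategoryTheory

/-- Every quasi-injective topos is totally distributive: if a locally
small category `E` is a retract, by geometric morphisms, of a presheaf topos `Ĉ` on a
small category `C` — i.e. there are geometric morphisms `s : E → Ĉ` (direct image
`sStar`, finite-limit-preserving inverse image `sUpper ⊣ sStar`) and `r : Ĉ → E`
(direct image `rStar`, finite-limit-preserving inverse image `rUpper ⊣ rStar`) with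
`sStar ⋙ rStar ≅ 𝟭 E` — then `E` is totally distributive. -/
theorem totallyDistributive_of_quasiInjective
    {C : Type v} [SmallCategory C] {E : Type u} [Category.{v} E]
    (sStar : E ⥤ (Cᵒᵖ ⥤ Type v)) (sUpper : (Cᵒᵖ ⥤ Type v) ⥤ E)
    (adjS : sUpper ⊣ sStar) [PreservesFiniteLimits sUpper]
    (rStar : (Cᵒᵖ ⥤ Type v) ⥤ E) (rUpper : E ⥤ (Cᵒᵖ ⥤ Type v))
    (adjR : rUpper ⊣ rStar) [PreservesFiniteLimits rUpper]
    (retr : sStar ⋙ rStar ≅ 𝟭 E) :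
    TotallyDistributive E := by
  have := adjR.rightAdjoint_preservesLimits
  have := hasLimitsOfShape_of_retract (J := WalkingParallelPair) sStar rStar retr
  have := isIdempotentComplete_of_hasEqualizers E
  exact totallyDistributive_of_yoneda_comp_iso
    (adjR.comp ((yoneda ⋙ sUpper).op.lanAdjunction (Type v)))
    (isoWhiskerRight (isoWhiskerRight adjS.compYonedaIso.symm
        ((whiskeringLeft _ _ (Type v)).obj yoneda.op) ≪≫
      isoWhiskerLeft sStar curriedYonedaLemma') rStar ≪≫ retr)
end

section
/- Let C be a small category and let E be an essential subtopos of Ĉ: there is a fully faithful functor s_* : E → Ĉ together with a functor s* : Ĉ → E and adjunctions s_! ⊣ s* ⊣ s_* for some functor s_! : E → Ĉ (so that s_! is also fully faithful). Then E is totally distributive. -/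
open CategoryTheory CategoryTheory.Limits

universe v u

namespace CategoryTheory

/-- Maps from the restriction of `P : Ĉᵒᵖ ⥤ Type v` along the Yoneda embedding to a presheaf `Q`
correspond to maps from `P` to the presheaf on `Ĉ` represented by `Q`. -/
def restrictYonedaHomEquiv {C : Type v} [SmallCategory C]
    (P : (Cᵒᵖ ⥤ Type v)ᵒᵖ ⥤ Type v) (Q : Cᵒᵖ ⥤ Type v) :
    (yoneda.op ⋙ P ⟶ Q) ≃ (P ⟶ yoneda.obj Q) where
  toFun α :=
    { app R := ↾fun p ↦
        { app X := ↾fun r ↦ α.app X (P.map (yonedaEquiv.symm r).op p)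
          naturality X Y f := by
            ext r
            have h := NatTrans.naturality_apply α f (P.map (yonedaEquiv.symm r).op p)
            refine Eq.trans ?_ h
            change α.app Y (P.map (yonedaEquiv.symm (R.unop.map f r)).op p) = _
            rw [yonedaEquiv_symm_map, op_comp, Functor.map_comp]
            rfl }
      naturality R S g := by
        ext p
        refine NatTrans.ext (funext fun X ↦ ?_)
        ext r
        change α.app X (P.map (yonedaEquiv.symm r).op (P.map g p)) =
          α.app X (P.map (yonedaEquiv.symm (g.unop.app X r)).op p)
        rw [← yonedaEquiv_symm_naturality_right, op_comp, Functor.map_comp]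
        rfl }
  invFun β :=
    { app X := ↾fun p ↦ yonedaEquiv (β.app (Opposite.op (yoneda.obj X.unop)) p)
      naturality X Y f := by
        ext p
        have h := NatTrans.naturality_apply β (yoneda.map f.unop).op p
        change yonedaEquiv (β.app _ (P.map (yoneda.map f.unop).op p)) =
          Q.map f (yonedaEquiv (β.app _ p))
        rw [yonedaEquiv_naturality']
        exact congrArg yonedaEquiv h }
  left_inv α := by
    ext X p
    change α.app X (P.map (yonedaEquiv.symm (𝟙 X.unop)).op p) = α.app X p
    have h : yonedaEquiv.symm (𝟙 X.unop) = 𝟙 (yoneda.obj X.unop) := by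
      rw [Equiv.symm_apply_eq]; rfl
    refine (congrArg (fun g ↦ α.app X (P.map g.op p)) h).trans ?_
    simp
  right_inv β := by
    ext R p
    refine NatTrans.ext (funext fun X ↦ ?_)
    ext r
    have h := NatTrans.naturality_apply β (yonedaEquiv.symm r).op p
    change yonedaEquiv (β.app _ (P.map (yonedaEquiv.symm r).op p)) = (β.app R p).app X r
    refine (congrArg yonedaEquiv h).trans ?_
    change yonedaEquiv (yonedaEquiv.symm r ≫ β.app R p) = _
    rw [yonedaEquiv_comp, Equiv.apply_symm_apply]

/-- Restriction along the Yoneda embedding of a small category `C` is left adjoint to the Yoneda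
embedding of `Ĉ`. -/
def restrictYonedaAdjunction (C : Type v) [SmallCategory C] :
    (Functor.whiskeringLeft _ _ (Type v)).obj (yoneda (C := C)).op ⊣
      yoneda (C := Cᵒᵖ ⥤ Type v) :=
  Adjunction.mkOfHomEquiv
    { homEquiv := restrictYonedaHomEquiv
      homEquiv_naturality_left_symm f g := by
        ext; rfl
      homEquiv_naturality_right f g := by
        ext; rfl }

/-- A fully faithful functor identifies the Yoneda embedding of its source with the restriction of
the presheaves represented by its values. -/
def Functor.FullyFaithful.yonedaIso {D : Type*} {E : Type*} [Category.{v} D] [Category.{v} E]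
    {F : E ⥤ D} (hF : F.FullyFaithful) :
    F ⋙ yoneda ⋙ (whiskeringLeft _ _ (Type v)).obj F.op ≅ yoneda :=
  NatIso.ofComponents
    (fun X ↦ NatIso.ofComponents (fun _ ↦ hF.homEquiv.symm.toIso) (fun f ↦ by
      ext; exact hF.map_injective (by simp)))
    (fun f ↦ by ext; exact hF.map_injective (by simp))

end CategoryTheory

/-- Let `C` be a small category and `E` an essential subtopos of `Ĉ`:
there is a fully faithful functor `sLower : E ⥤ Ĉ` together with `sStar : Ĉ ⥤ E` and
an adjoint triple `sShriek ⊣ sStar ⊣ sLower` (so that `sShriek` is also fully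
faithful).  Then `E` is totally distributive. -/
theorem totallyDistributive_of_essentialSubtopos
    {C : Type v} [SmallCategory C] {E : Type u} [Category.{v} E]
    (sLower : E ⥤ (Cᵒᵖ ⥤ Type v)) [sLower.Full] [sLower.Faithful]
    (sStar : (Cᵒᵖ ⥤ Type v) ⥤ E) (sShriek : E ⥤ (Cᵒᵖ ⥤ Type v))
    (adj₁ : sShriek ⊣ sStar) (adj₂ : sStar ⊣ sLower) :
    TotallyDistributive E := by
  let r := (Functor.whiskeringLeft _ _ (Type v)).obj (yoneda (C := C)).op
  refine ⟨sShriek ⋙ (yoneda (C := C)).op.lan ⋙ (Functor.whiskeringLeft _ _ _).obj sShriek.op,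
    (Functor.whiskeringLeft _ _ _).obj sStar.op ⋙ r ⋙ sStar, ⟨?_⟩, ⟨?_⟩⟩
  · exact adj₁.comp (((yoneda (C := C)).op.lanAdjunction (Type v)).comp
      (adj₁.op.whiskerLeft (Type v)))
  · exact ((adj₂.op.whiskerLeft (Type v)).comp
      ((restrictYonedaAdjunction C).comp adj₂)).ofNatIsoRight
      (Functor.FullyFaithful.ofFullyFaithful sLower).yonedaIso
end
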